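/- Let λ be an infinite cardinal and let G be a graph that admits a λ-covering. Then there exists a well-ordering of the vertex set of G of order type |V(G)| such that every vertex v has at most λ many edges joining it to vertices preceding v in this well-ordering; in particular, the colouring number of G is at most λ⁺. -/

import Mathlib

universe u
open Cardinal

/-- `T` is a spanning tree of `G`: a connected, acyclic subgraph of `G`
containing all vertices of `G` (as `T` lives on the same vertex type `V`,
connectedness of `T` already makes it spanning). -/
def IsSpanningTree {V : Type u} (G T : SimpleGraph V) : Prop :=
  T ≤ G ∧ T.IsTree

/-- A λ-covering of `G`: a family of λ many spanning trees whose edge sets cover the edge set of `G`. -/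
def HasCovering {V : Type u} (G : SimpleGraph V) (lam : Cardinal.{u}) : Prop :=
  ∃ (ι : Type u) (T : ι → SimpleGraph V), #ι = lam ∧
    (∀ i, IsSpanningTree G (T i)) ∧
    (⋃ i, (T i).edgeSet) = G.edgeSet

/-- The colouring number of `G`: the smallest cardinal `μ` such that there is a
well-ordering of `V` in which every vertex has strictly fewer than `μ` edges to
earlier vertices (in a simple graph, edges from `v` to earlier vertices correspond
to earlier neighbours of `v`). -/
noncomputable def colNumber {V : Type u} (G : SimpleGraph V) : Cardinal.{u} :=
  sInf {μ : Cardinal.{u} | ∃ r : V → V → Prop, IsWellOrder V r ∧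
    ∀ v, #{w : V // r w v ∧ G.Adj w v} < μ}

/-- The edges of a tree can be oriented so that every vertex has at most one outgoing edge. -/
lemma SimpleGraph.IsTree.exists_parent {V : Type u} {T : SimpleGraph V} (hT : T.IsTree) :
    ∃ p : V → V, ∀ v w, T.Adj v w → p v = w ∨ p w = v := by
  obtain ⟨root⟩ := hT.connected.nonempty
  choose f hf _ using (hT.existsUnique_path · root)
  refine ⟨fun v ↦ (f v).snd, fun v w h ↦ ?_⟩
  by_cases hw : w ∈ (f v).support
  · exact .inl (hT.isAcyclic.eq_snd_of_adj_start (hf v) h hw).symm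
  · refine .inr (hT.isAcyclic.eq_snd_of_adj_start (hf w) h.symm ?_).symm
    simpa using hT.isAcyclic.mem_support_of_ne_mem_support_of_adj_of_isPath
      (hf w).reverse (hf v).reverse h.symm (by simpa using hw)

/-- The vertices obtained from `a` by iterating the functions `p i`. -/
def iterateClosure {ι V : Type u} (p : ι → V → V) (a : V) : Set V :=
  Set.range fun l : List ι ↦ l.foldr p a

lemma mem_iterateClosure_self {ι V : Type u} (p : ι → V → V) (a : V) :
    a ∈ iterateClosure p a :=
  ⟨[], rfl⟩

lemma apply_mem_iterateClosure {ι V : Type u} {p : ι → V → V} {a v : V} (i : ι)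
    (hv : v ∈ iterateClosure p a) : p i v ∈ iterateClosure p a := by
  obtain ⟨l, rfl⟩ := hv
  exact ⟨i :: l, rfl⟩

lemma mk_iterateClosure_le {ι V : Type u} [Infinite ι] (p : ι → V → V) (a : V) :
    #(iterateClosure p a) ≤ #ι :=
  mk_range_le.trans (mk_list_eq_mk ι).le

/-- A well-ordering all of whose proper initial segments are smaller than the whole set
has the least possible order type. -/
lemma type_eq_ord_of_mk_initial_lt {V : Type u} (r : V → V → Prop) [IsWellOrder V r]
    (h : ∀ v, #{w // r w v} < #V) : Ordinal.type r = (#V).ord := by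
  refine le_antisymm (le_of_forall_lt fun o ho ↦ ?_) (ord_le.2 (Ordinal.card_type r).ge)
  obtain ⟨v, rfl⟩ := Ordinal.typein_surj r ho
  exact lt_ord.2 (h v)

/-- If every edge of `G` is oriented by one of `#ι` many functions on the vertices, then `V` has a
well-ordering of minimal type with at most `#ι` many edges from each vertex to earlier ones. -/
lemma exists_wellOrder_of_orientation {ι V : Type u} [Infinite ι] (G : SimpleGraph V)
    (p : ι → V → V) (hp : ∀ v w, G.Adj v w → ∃ i, p i v = w ∨ p i w = v) :
    ∃ (r : V → V → Prop) (hwo : IsWellOrder V r), @Ordinal.type V r hwo = (#V).ord ∧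
      ∀ v, #{w : V // r w v ∧ G.Adj w v} ≤ #ι := by
  obtain ⟨s, hs, htype⟩ := exists_ord_eq V
  rcases le_or_gt #V #ι with hV | hV
  · exact ⟨s, hs, htype.symm, fun v ↦ (mk_subtype_le _).trans hV⟩
  have hwf : WellFounded s := hs.wf
  have hinf : ℵ₀ ≤ #ι := aleph0_le_mk ι
  let f (v : V) : V := hwf.min {a | v ∈ iterateClosure p a} ⟨v, mem_iterateClosure_self p v⟩
  have hf (v : V) : v ∈ iterateClosure p (f v) :=
    hwf.min_mem {a | v ∈ iterateClosure p a} _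
  have hmin {v a : V} (h : v ∈ iterateClosure p a) : ¬ s a (f v) :=
    hwf.not_lt_min {a | v ∈ iterateClosure p a} h
  let e : V ↪ V × V := ⟨fun v ↦ (f v, v), fun _ _ h ↦ congrArg Prod.snd h⟩
  let r : V → V → Prop := Order.Preimage e (Prod.Lex s s)
  have hr {w v : V} (h : r w v) : f w = f v ∨ s (f w) (f v) := by
    rcases (Prod.lex_def ..).1 h with h | h
    · exact .inr h
    · exact .inl h.1
  have hwo : IsWellOrder V r := (RelEmbedding.preimage e (Prod.Lex s s)).isWellOrder
  refine ⟨r, hwo, type_eq_ord_of_mk_initial_lt r fun v ↦ ?_, fun v ↦ ?_⟩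
  · let S : Set V := insert (f v) {a | s a (f v)}
    have hS : #S < #V := by
      refine mk_insert_le.trans_lt (add_lt_of_lt (hinf.trans hV.le) ?_
        (one_lt_aleph0.trans_le (hinf.trans hV.le)))
      exact lt_ord.1 (htype ▸ Ordinal.typein_lt_type s (f v))
    have hsub : {w | r w v} ⊆ ⋃ a ∈ S, iterateClosure p a := fun w hw ↦
      Set.mem_biUnion (x := f w) (hr hw) (hf w)
    calc #{w | r w v} ≤ #(⋃ a ∈ S, iterateClosure p a) := mk_le_mk_of_subset hsub
      _ ≤ #S * ⨆ a : S, #(iterateClosure p a.1) := mk_biUnion_le _ _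
      _ ≤ #S * #ι := by
        gcongr
        exact ciSup_le' fun a ↦ mk_iterateClosure_le p a.1
      _ < #V := mul_lt_of_lt (hinf.trans hV.le) hS hV
  · have hsub : {w | r w v ∧ G.Adj w v} ⊆ Set.range (p · v) ∪ iterateClosure p (f v) := by
      rintro w ⟨hw, hadj⟩
      obtain ⟨i, h | h⟩ := hp w v hadj
      · rcases hr hw with h' | h'
        · exact .inr (h' ▸ hf w)
        · exact (hmin (h ▸ apply_mem_iterateClosure i (hf w)) h').elim
      · exact .inl ⟨i, h⟩
    calc #{w | r w v ∧ G.Adj w v} ≤ _ := mk_le_mk_of_subset hsub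
      _ ≤ #(Set.range (p · v)) + #(iterateClosure p (f v)) := mk_union_le _ _
      _ ≤ #ι := add_le_of_le hinf mk_range_le (mk_iterateClosure_le p _)

/-- If λ is infinite and `G` admits a λ-covering, then there is a well-ordering of
its vertex set of order type `#V` in which every vertex has at most λ many edges to
earlier vertices; in particular, the colouring number of `G` is at most λ⁺. -/
theorem wellOrder_of_covering {V : Type u} (G : SimpleGraph V)
    (lam : Cardinal.{u}) (hlam : aleph0 ≤ lam) (hcov : HasCovering G lam) :
    (∃ (r : V → V → Prop) (hwo : IsWellOrder V r),
      @Ordinal.type V r hwo = (#V).ord ∧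
      ∀ v, #{w : V // r w v ∧ G.Adj w v} ≤ lam) ∧
    colNumber G ≤ Order.succ lam := by
  obtain ⟨ι, T, rfl, hT, hcover⟩ := hcov
  have : Infinite ι := infinite_iff.2 hlam
  choose p hp using fun i ↦ (hT i).2.exists_parent
  have hex := exists_wellOrder_of_orientation G p fun v w h ↦ by
    have hmem : s(v, w) ∈ ⋃ i, (T i).edgeSet := hcover ▸ h
    obtain ⟨i, hi⟩ := Set.mem_iUnion.1 hmem
    exact ⟨i, hp i v w hi⟩
  refine ⟨hex, ?_⟩
  obtain ⟨r, hwo, -, hle⟩ := hex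
  exact csInf_le' ⟨r, hwo, fun v ↦ Order.lt_succ_of_le (hle v)⟩
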